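/- arXiv:math/9801063 — 9 statements merged into one kernel-verified Lean document; each statement's English description precedes it below -/
import Mathlib

section
/- Let a ∈ ℝ and let u : ℝ → ℝ be three times continuously differentiable and satisfy the third-order ODE 2 u''(y)² − 3 u(y)² + u'(y) u'''(y) = a/2 for all y ∈ ℝ. Then there exist constants b, b₁ ∈ ℝ such that u'(y)⁴ = b + b₁ u(y) + a u(y)² + u(y)⁴ for all y ∈ ℝ. -/
/-- If `u : ℝ → ℝ` is `C³` and satisfies
`2 u''² − 3 u² + u' u''' = a/2` everywhere, then there are constants `b, b₁` with
`u'⁴ = b + b₁ u + a u² + u⁴` everywhere. -/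
theorem ode_third_order_implies_first_order (a : ℝ) (u : ℝ → ℝ)
    (hu : ContDiff ℝ 3 u)
    (hode : ∀ y : ℝ,
      2 * (iteratedDeriv 2 u y) ^ 2 - 3 * (u y) ^ 2
        + deriv u y * iteratedDeriv 3 u y = a / 2) :
    ∃ b b₁ : ℝ, ∀ y : ℝ,
      (deriv u y) ^ 4 = b + b₁ * u y + a * (u y) ^ 2 + (u y) ^ 4 := by
  have h₁ (y : ℝ) : HasDerivAt u (deriv u y) y :=
    (hu.differentiable (by norm_num) y).hasDerivAt
  have h₂ (y : ℝ) : HasDerivAt (deriv u) (iteratedDeriv 2 u y) y := by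
    have h := (hu.differentiable_iteratedDeriv 1 (by norm_num) y).hasDerivAt
    rwa [← iteratedDeriv_succ, iteratedDeriv_one] at h
  have h₃ (y : ℝ) : HasDerivAt (iteratedDeriv 2 u) (iteratedDeriv 3 u y) y := by
    have h := (hu.differentiable_iteratedDeriv 2 (by norm_num) y).hasDerivAt
    rwa [← iteratedDeriv_succ] at h
  -- `4 u'² u'' - 2 a u - 4 u³` is a first integral; its value is `b₁`.
  let G : ℝ → ℝ := fun y ↦
    4 * (deriv u y ^ 2 * iteratedDeriv 2 u y) - 2 * a * u y - 4 * u y ^ 3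
  have hG (y : ℝ) : HasDerivAt G 0 y := by
    refine ((((((h₂ y).fun_pow 2).fun_mul (h₃ y)).const_mul 4).fun_sub
      ((h₁ y).const_mul (2 * a))).fun_sub (((h₁ y).fun_pow 3).const_mul 4)).congr_deriv ?_
    push_cast
    linear_combination 4 * deriv u y * hode y
  have hG_const (y : ℝ) : G y = G 0 :=
    is_const_of_deriv_eq_zero (fun x ↦ (hG x).differentiableAt) (fun x ↦ (hG x).deriv) y 0
  let F : ℝ → ℝ := fun y ↦ deriv u y ^ 4 - G 0 * u y - a * u y ^ 2 - u y ^ 4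
  have hF (y : ℝ) : HasDerivAt F 0 y := by
    refine (((((h₂ y).fun_pow 4).fun_sub ((h₁ y).const_mul (G 0))).fun_sub
      (((h₁ y).fun_pow 2).const_mul a)).fun_sub ((h₁ y).fun_pow 4)).congr_deriv ?_
    rw [← hG_const y]
    simp only [G]
    push_cast
    ring
  refine ⟨F 0, G 0, fun y ↦ ?_⟩
  have hF_const : F y = F 0 :=
    is_const_of_deriv_eq_zero (fun x ↦ (hF x).differentiableAt) (fun x ↦ (hF x).deriv) y 0
  rw [← hF_const]
  simp only [F]
  ring
end

section
/- Let a, b, b₁ ∈ ℝ and let u : ℝ → ℝ be three times continuously differentiable with u'(y) ≠ 0 for all y, and suppose u'(y)⁴ = b + b₁ u(y) + a u(y)² + u(y)⁴ for all y ∈ ℝ. Then u satisfies 2 u''(y)² − 3 u(y)² + u'(y) u'''(y) = a/2 for all y ∈ ℝ. -/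
/-- A `C¹` function with nowhere-vanishing derivative satisfying `u'⁴ = b + b₁ u + a u² + u⁴`
and whose derivative is differentiable satisfies `4 u'' u'² = b₁ + 2 a u + 4 u³`. -/
theorem four_mul_deriv_deriv_mul_deriv_sq {a b b₁ : ℝ} {u : ℝ → ℝ}
    (hu : Differentiable ℝ u) (hdu : Differentiable ℝ (deriv u))
    (hu' : ∀ y, deriv u y ≠ 0)
    (hode : ∀ y, deriv u y ^ 4 = b + b₁ * u y + a * u y ^ 2 + u y ^ 4) (y : ℝ) :
    4 * deriv (deriv u) y * deriv u y ^ 2 = b₁ + 2 * a * u y + 4 * u y ^ 3 := by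
  have h₁ := (hu y).hasDerivAt
  have hl := (hdu y).hasDerivAt.fun_pow 4
  have hr := (((h₁.const_mul b₁).const_add b).fun_add
    ((h₁.fun_pow 2).const_mul a)).fun_add (h₁.fun_pow 4)
  rw [← funext hode] at hr
  have h := hl.unique hr
  norm_num at h
  apply mul_left_cancel₀ (hu' y)
  linear_combination h

/-- If `u : ℝ → ℝ` is `C³` with nowhere-vanishing derivative and
`u'⁴ = b + b₁ u + a u² + u⁴` everywhere, then `2 u''² − 3 u² + u' u''' = a/2`
everywhere. -/
theorem ode_first_order_implies_third_order (a b b₁ : ℝ) (u : ℝ → ℝ)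
    (hu : ContDiff ℝ 3 u)
    (hu' : ∀ y : ℝ, deriv u y ≠ 0)
    (hode : ∀ y : ℝ,
      (deriv u y) ^ 4 = b + b₁ * u y + a * (u y) ^ 2 + (u y) ^ 4) :
    ∀ y : ℝ,
      2 * (iteratedDeriv 2 u y) ^ 2 - 3 * (u y) ^ 2
        + deriv u y * iteratedDeriv 3 u y = a / 2 := by
  intro y
  have hd₀ : Differentiable ℝ u := hu.differentiable (by norm_num)
  have hd₁ : Differentiable ℝ (deriv u) := by
    simpa only [iteratedDeriv_one] using hu.differentiable_iteratedDeriv 1 (by norm_num)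
  have e₂ : iteratedDeriv 2 u = deriv (deriv u) := by
    rw [iteratedDeriv_succ, iteratedDeriv_one]
  have e₃ : iteratedDeriv 3 u = deriv (deriv (deriv u)) := by
    rw [iteratedDeriv_succ, e₂]
  have hd₂ : Differentiable ℝ (deriv (deriv u)) :=
    e₂ ▸ hu.differentiable_iteratedDeriv 2 (by norm_num)
  have h₁ := (hd₀ y).hasDerivAt
  have hl := ((hd₂ y).hasDerivAt.const_mul 4).fun_mul ((hd₁ y).hasDerivAt.fun_pow 2)
  have hr := ((h₁.const_mul (2 * a)).const_add b₁).fun_add ((h₁.fun_pow 3).const_mul 4)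
  rw [← funext (four_mul_deriv_deriv_mul_deriv_sq hd₀ hd₁ hu' hode)] at hr
  have h := hl.unique hr
  norm_num at h
  rw [e₂, e₃]
  apply mul_left_cancel₀ (hu' y)
  linear_combination h / 4
end

section
/- Let a > −2 and let u_a : ℝ → ℝ be the unique global solution of u' = (1 + a u² + u⁴)^{1/4} with u(0) = 0. Then u_a is an odd function: u_a(−y) = −u_a(y) for all y ∈ ℝ. -/
/-- Two global solutions of a scalar autonomous equation `u' = f u` with `f` continuous and
positive agree as soon as they agree at `0`: both are inverse to the primitive of `1 / f`. -/
theorem eq_of_hasDerivAt_autonomous_of_pos {f u v : ℝ → ℝ} (hf : Continuous f)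
    (hpos : ∀ x, 0 < f x) (hu : ∀ y, HasDerivAt u (f (u y)) y)
    (hv : ∀ y, HasDerivAt v (f (v y)) y) (h0 : u 0 = v 0) : u = v := by
  set G : ℝ → ℝ := fun x => ∫ t in (u 0)..x, (f t)⁻¹ with hG
  have hGd : ∀ x, HasDerivAt G (f x)⁻¹ x := fun x =>
    (hf.inv₀ fun x => (hpos x).ne').integral_hasStrictDerivAt (u 0) x |>.hasDerivAt
  have hmono : StrictMono G := strictMono_of_hasDerivAt_pos hGd fun x => inv_pos.2 (hpos x)
  have key : ∀ w : ℝ → ℝ, (∀ y, HasDerivAt w (f (w y)) y) → w 0 = u 0 → ∀ y, G (w y) = y := by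
    intro w hw hw0 y
    have hd : ∀ z, HasDerivAt (fun z => G (w z) - z) 0 z := fun z => by
      have h := ((hGd (w z)).comp z (hw z)).sub (hasDerivAt_id z)
      rw [inv_mul_cancel₀ (hpos (w z)).ne', sub_self] at h
      exact h
    have hc := is_const_of_deriv_eq_zero (fun z => (hd z).differentiableAt)
      (fun z => (hd z).deriv) y 0
    have hG0 : G (w 0) = 0 := by simp [hG, hw0]
    simp only [hG0] at hc
    linarith
  funext y
  exact hmono.injective ((key u hu rfl y).trans (key v hv h0.symm y).symm)

/-- For `a > −2`, the (unique) global solution of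
`u' = (1 + a u² + u⁴)^{1/4}`, `u 0 = 0`, is an odd function. -/
theorem ode_solution_odd (a : ℝ) (ha : -2 < a) (u : ℝ → ℝ)
    (hu : ∀ y : ℝ, HasDerivAt u ((1 + a * (u y) ^ 2 + (u y) ^ 4) ^ ((1 : ℝ) / 4)) y)
    (h0 : u 0 = 0) :
    ∀ y : ℝ, u (-y) = -u y := by
  set f : ℝ → ℝ := fun x => (1 + a * x ^ 2 + x ^ 4) ^ ((1 : ℝ) / 4) with hf
  have hbase : ∀ x : ℝ, 0 < 1 + a * x ^ 2 + x ^ 4 := by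
    intro x
    rcases eq_or_ne x 0 with rfl | hx
    · norm_num
    · have h1 : 0 < (a + 2) * x ^ 2 := mul_pos (by linarith) (by positivity)
      nlinarith [sq_nonneg (x ^ 2 - 1)]
  have hcont : Continuous f := by
    refine Continuous.rpow_const (by fun_prop) fun x => Or.inl (hbase x).ne'
  have hv : ∀ y, HasDerivAt (fun z => -u (-z)) (f (-u (-y))) y := by
    intro y
    have h := ((hu (-y)).comp y (hasDerivAt_neg y)).neg
    have he : f (-u (-y)) = -((1 + a * (u (-y)) ^ 2 + (u (-y)) ^ 4) ^ ((1 : ℝ) / 4) * -1) := by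
      simp [hf, Even.neg_pow (show Even 4 by decide)]
    rw [he]
    exact h
  have huv := eq_of_hasDerivAt_autonomous_of_pos hcont
    (fun x => Real.rpow_pos_of_pos (hbase x) _) hu hv (by simp [h0])
  intro y
  have := congrFun huv y
  linarith
end

section
/- Let a > −2 and let c₀ ∈ ℝ satisfy c₀ ≥ 1 and 6 c₀² ≥ a. Then: (i) for every x ≥ 0 one has (1 + a x² + x⁴)^{1/4} ≤ x + c₀; and (ii) if u : [0,∞) → ℝ is differentiable with u(0) ≥ 0 and u'(y) = (1 + a u(y)² + u(y)⁴)^{1/4} for all y ≥ 0, then u(y) ≤ (u(0) + c₀) e^y − c₀ for all y ≥ 0; in particular e^{−y} u(y) ≤ u(0) + c₀ for all y ≥ 0. -/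
/-- The binomial expansion of `(x + c) ^ 4` dominates `1 + a x² + x⁴`. -/
theorem rpow_quartic_le_add {a c x : ℝ} (ha : -2 < a) (hc : 1 ≤ c) (hac : a ≤ 6 * c ^ 2)
    (hx : 0 ≤ x) : (1 + a * x ^ 2 + x ^ 4) ^ ((1 : ℝ) / 4) ≤ x + c := by
  have hnonneg : 0 ≤ 1 + a * x ^ 2 + x ^ 4 := by
    nlinarith [sq_nonneg (1 - x ^ 2), mul_nonneg (by linarith : 0 ≤ a + 2) (sq_nonneg x)]
  have hc₀ : 0 ≤ c := by linarith
  have hle : 1 + a * x ^ 2 + x ^ 4 ≤ (x + c) ^ 4 := by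
    have hmul : a * x ^ 2 ≤ 6 * c ^ 2 * x ^ 2 := by gcongr
    have hone : 1 ≤ c ^ 4 := one_le_pow₀ hc
    have hcross : 0 ≤ 4 * x ^ 3 * c + 4 * x * c ^ 3 := by positivity
    nlinarith
  calc (1 + a * x ^ 2 + x ^ 4) ^ ((1 : ℝ) / 4)
      ≤ ((x + c) ^ 4) ^ ((1 : ℝ) / 4) := by gcongr
    _ = x + c := by
      rw [one_div]
      exact_mod_cast Real.pow_rpow_inv_natCast (n := 4) (by positivity : 0 ≤ x + c) (by norm_num)

/-- A differential inequality `u' ≤ u + c` on `[0, ∞)` implies exponential growth at most. -/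
theorem exp_neg_mul_add_le_of_deriv_le {u u' : ℝ → ℝ} {c : ℝ}
    (hu : ∀ y, 0 ≤ y → HasDerivAt u (u' y) y) (hle : ∀ y, 0 ≤ y → u' y ≤ u y + c)
    {y : ℝ} (hy : 0 ≤ y) : Real.exp (-y) * (u y + c) ≤ u 0 + c := by
  have hderiv : ∀ z, 0 ≤ z → HasDerivAt (fun t => Real.exp (-t) * (u t + c))
      (Real.exp (-z) * -1 * (u z + c) + Real.exp (-z) * u' z) z := fun z hz =>
    (hasDerivAt_neg z).exp.mul ((hu z hz).add_const c)
  have hanti : AntitoneOn (fun t => Real.exp (-t) * (u t + c)) (Set.Ici 0) := by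
    refine antitoneOn_of_hasDerivWithinAt_nonpos (convex_Ici 0)
      (fun z hz => (hderiv z hz).continuousAt.continuousWithinAt)
      (fun z hz => (hderiv z (interior_subset hz)).hasDerivWithinAt) fun z hz => ?_
    nlinarith [hle z (interior_subset hz), Real.exp_pos (-z)]
  simpa using hanti Set.self_mem_Ici hy hy


/-- For `a > −2` and `c₀ ≥ 1` with `6 c₀² ≥ a`:
(i) `(1 + a x² + x⁴)^{1/4} ≤ x + c₀` for all `x ≥ 0`; and
(ii) any solution `u` of `u' = (1 + a u² + u⁴)^{1/4}` on `[0,∞)` with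
`u 0 ≥ 0` satisfies `u y ≤ (u 0 + c₀) e^y − c₀`, in particular
`e^{−y} u y ≤ u 0 + c₀`, for all `y ≥ 0`. -/
theorem ode_exponential_growth_bound (a c₀ : ℝ) (ha : -2 < a)
    (hc₀ : 1 ≤ c₀) (hc₀' : a ≤ 6 * c₀ ^ 2) :
    (∀ x : ℝ, 0 ≤ x → (1 + a * x ^ 2 + x ^ 4) ^ ((1 : ℝ) / 4) ≤ x + c₀) ∧
    ∀ u : ℝ → ℝ, 0 ≤ u 0 →
      (∀ y : ℝ, 0 ≤ y →
        HasDerivAt u ((1 + a * (u y) ^ 2 + (u y) ^ 4) ^ ((1 : ℝ) / 4)) y) →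
      ∀ y : ℝ, 0 ≤ y →
        u y ≤ (u 0 + c₀) * Real.exp y - c₀ ∧
        Real.exp (-y) * u y ≤ u 0 + c₀ := by
  refine ⟨fun x hx => rpow_quartic_le_add ha hc₀ hc₀' hx, fun u hu₀ hu y hy => ?_⟩
  have hmono : MonotoneOn u (Set.Ici 0) := by
    refine monotoneOn_of_hasDerivWithinAt_nonneg (convex_Ici 0)
      (fun z hz => (hu z hz).continuousAt.continuousWithinAt)
      (fun z hz => (hu z (interior_subset hz)).hasDerivWithinAt) fun z _ => ?_
    refine Real.rpow_nonneg ?_ _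
    nlinarith [sq_nonneg (1 - u z ^ 2), mul_nonneg (by linarith : 0 ≤ a + 2) (sq_nonneg (u z))]
  have hbound := exp_neg_mul_add_le_of_deriv_le hu (fun z hz =>
    rpow_quartic_le_add ha hc₀ hc₀' (hu₀.trans (hmono Set.self_mem_Ici hz hz))) hy
  constructor
  · rw [Real.exp_neg, inv_mul_le_iff₀ (Real.exp_pos y)] at hbound
    linarith
  · nlinarith [Real.exp_pos (-y)]
end

section
/- Let a > −2 and let u_a : ℝ → ℝ be the unique global solution of u' = (1 + a u² + u⁴)^{1/4} with u(0) = 0. Then the limit L = lim_{y → +∞} e^{−y} u_a(y) exists, is finite, and is strictly positive. -/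
open Filter

/-- For `a > -2` the quartic `1 + a x² + x⁴` is bounded below by a positive constant. -/
lemma exists_pos_le_quartic (a : ℝ) (ha : -2 < a) :
    ∃ m : ℝ, 0 < m ∧ ∀ x : ℝ, m ≤ 1 + a * x ^ 2 + x ^ 4 := by
  rcases le_total 0 a with h | h
  · refine ⟨1, one_pos, fun x => ?_⟩
    have : 0 ≤ a * x ^ 2 := by positivity
    have : 0 ≤ x ^ 4 := by positivity
    linarith
  · refine ⟨1 + a / 2, by linarith, fun x => ?_⟩
    have h1 : 0 ≤ (-a) * (1 - x ^ 2) ^ 2 := mul_nonneg (by linarith) (sq_nonneg _)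
    have h2 : 0 ≤ (1 + a / 2) * x ^ 4 := mul_nonneg (by linarith) (by positivity)
    nlinarith

/-- If `f⁴ = 1 + a x² + x⁴` with `f ≥ 0` and `x ≥ 1`, then `f` differs from `x` by `O(1 / x)`. -/
lemma abs_sub_mul_le_of_pow_four_eq {a f x : ℝ} (hf : 0 ≤ f) (hx : 1 ≤ x)
    (h : f ^ 4 = 1 + a * x ^ 2 + x ^ 4) : |f - x| * x ≤ 1 + |a| := by
  have hx0 : 0 < x := by linarith
  have hx2 : 1 ≤ x ^ 2 := one_le_pow₀ hx
  have hS : x ^ 3 ≤ f ^ 3 + f ^ 2 * x + f * x ^ 2 + x ^ 3 := by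
    have : 0 ≤ f ^ 3 + f ^ 2 * x + f * x ^ 2 := by positivity
    linarith
  have hprod : |f - x| * (f ^ 3 + f ^ 2 * x + f * x ^ 2 + x ^ 3) = |1 + a * x ^ 2| := by
    rw [← abs_of_nonneg (le_trans (by positivity) hS), ← abs_mul]
    congr 1
    linear_combination h
  have hbound : |1 + a * x ^ 2| ≤ (1 + |a|) * x ^ 2 := by
    calc |1 + a * x ^ 2| ≤ |1| + |a * x ^ 2| := abs_add_le _ _
      _ = 1 + |a| * x ^ 2 := by rw [abs_one, abs_mul, abs_of_nonneg (sq_nonneg x)]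
      _ ≤ (1 + |a|) * x ^ 2 := by linarith
  have hmul : |f - x| * x ^ 3 ≤ (1 + |a|) * x ^ 2 :=
    (mul_le_mul_of_nonneg_left hS (abs_nonneg _)).trans (hprod.le.trans hbound)
  refine le_of_mul_le_mul_right ?_ (by positivity : 0 < x ^ 2)
  calc |f - x| * x * x ^ 2 = |f - x| * x ^ 3 := by ring
    _ ≤ _ := hmul

/-- If `|h'| ≤ -φ'` on a half-line and `φ ≥ 0` tends to `0`, then `h` converges at infinity. -/
lemma exists_tendsto_atTop_of_abs_deriv_le {h φ h' φ' : ℝ → ℝ} {Y : ℝ}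
    (hh : ∀ y, Y ≤ y → HasDerivAt h (h' y) y) (hφ : ∀ y, Y ≤ y → HasDerivAt φ (φ' y) y)
    (hle : ∀ y, Y ≤ y → |h' y| ≤ -φ' y) (hnonneg : ∀ y, Y ≤ y → 0 ≤ φ y)
    (hlim : Tendsto φ atTop (nhds 0)) : ∃ l, Tendsto h atTop (nhds l) := by
  have hanti : AntitoneOn (fun y => h y + φ y) (Set.Ici Y) := by
    refine antitoneOn_of_hasDerivWithinAt_nonpos (f' := fun y => h' y + φ' y) (convex_Ici Y)
      (fun y hy => ((hh y hy).add (hφ y hy)).continuousAt.continuousWithinAt) ?_ ?_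
    · intro y hy
      have hy' : Y ≤ y := interior_subset hy
      exact ((hh y hy').add (hφ y hy')).hasDerivWithinAt
    · intro y hy
      linarith [le_abs_self (h' y), hle y (interior_subset hy)]
  have hmono : MonotoneOn (fun y => h y - φ y) (Set.Ici Y) := by
    refine monotoneOn_of_hasDerivWithinAt_nonneg (f' := fun y => h' y - φ' y) (convex_Ici Y)
      (fun y hy => ((hh y hy).sub (hφ y hy)).continuousAt.continuousWithinAt) ?_ ?_
    · intro y hy
      have hy' : Y ≤ y := interior_subset hy
      exact ((hh y hy').sub (hφ y hy')).hasDerivWithinAt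
    · intro y hy
      linarith [neg_abs_le (h' y), hle y (interior_subset hy)]
  have hanti' : Antitone (fun y => h (max y Y) + φ (max y Y)) := fun x y hxy =>
    hanti (le_max_right x Y) (le_max_right y Y) (max_le_max_right Y hxy)
  have hbdd : BddBelow (Set.range fun y => h (max y Y) + φ (max y Y)) := by
    refine ⟨h Y - φ Y, ?_⟩
    rintro _ ⟨y, rfl⟩
    have h1 : h Y - φ Y ≤ h (max y Y) - φ (max y Y) :=
      hmono Set.self_mem_Ici (le_max_right y Y) (le_max_right y Y)
    have h2 := hnonneg _ (le_max_right y Y)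
    dsimp only
    linarith
  have hconv := (tendsto_atTop_ciInf hanti' hbdd).congr' (f₂ := fun y => h y + φ y) <| by
    filter_upwards [eventually_ge_atTop Y] with y hy
    rw [max_eq_left hy]
  exact ⟨_, by simpa using hconv.sub hlim⟩

/-- For `a > −2` and `u_a` the global solution of
`u' = (1 + a u² + u⁴)^{1/4}` with `u 0 = 0`, the limit
`L = lim_{y → +∞} e^{−y} u_a y` exists, is finite and strictly positive. -/
theorem exp_normalized_limit_exists (a : ℝ) (ha : -2 < a) (u : ℝ → ℝ)
    (hu : ∀ y : ℝ, HasDerivAt u ((1 + a * (u y) ^ 2 + (u y) ^ 4) ^ ((1 : ℝ) / 4)) y)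
    (h0 : u 0 = 0) :
    ∃ L : ℝ, 0 < L ∧
      Tendsto (fun y : ℝ => Real.exp (-y) * u y) atTop (nhds L) := by
  obtain ⟨m, hm, hmle⟩ := exists_pos_le_quartic a ha
  set F : ℝ → ℝ := fun y => (1 + a * (u y) ^ 2 + (u y) ^ 4) ^ ((1 : ℝ) / 4) with hF
  set c : ℝ := m ^ ((1 : ℝ) / 4)
  have hc : 0 < c := Real.rpow_pos_of_pos hm _
  have hcF : ∀ y, c ≤ F y := fun y => Real.rpow_le_rpow hm.le (hmle (u y)) (by norm_num)
  have hF4 : ∀ y, F y ^ 4 = 1 + a * (u y) ^ 2 + (u y) ^ 4 := fun y => by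
    rw [hF, ← Real.rpow_natCast, ← Real.rpow_mul (hm.le.trans (hmle (u y)))]
    norm_num
  have hgrow : ∀ y, 0 ≤ y → c * y ≤ u y := by
    have hd : ∀ y, HasDerivAt (fun y => u y - c * y) (F y - c * 1) y := fun y =>
      (hu y).sub ((hasDerivAt_id y).const_mul c)
    have hmono : Monotone fun y => u y - c * y :=
      monotone_of_hasDerivAt_nonneg hd fun y => by
        have := hcF y
        simp only [Pi.zero_apply]
        linarith
    intro y hy
    have := hmono hy
    simp only [h0] at this
    linarith
  have hu1 : ∀ y, 1 / c ≤ y → 1 ≤ u y := fun y hy => by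
    refine le_trans ?_ (hgrow y (le_trans (by positivity) hy))
    rwa [div_le_iff₀' hc] at hy
  have htop : Tendsto u atTop atTop :=
    tendsto_atTop_mono' _ ((eventually_ge_atTop 0).mono hgrow) (tendsto_id.const_mul_atTop hc)
  set K : ℝ := 1 + |a|
  obtain ⟨l, hl⟩ := exists_tendsto_atTop_of_abs_deriv_le (Y := 1 / c)
    (h := fun y => Real.log (u y) - y) (φ := fun y => K / c * (u y)⁻¹)
    (h' := fun y => F y / u y - 1) (φ' := fun y => K / c * (-F y / u y ^ 2))
    (fun y hy => ((hu y).log (by linarith [hu1 y hy])).sub (hasDerivAt_id y))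
    (fun y hy => ((hu y).inv (by linarith [hu1 y hy])).const_mul _)
    (fun y hy => by
      have h1 := hu1 y hy
      have hpos : 0 < u y := by linarith
      have hK := abs_sub_mul_le_of_pow_four_eq (hc.le.trans (hcF y)) h1 (hF4 y)
      have hK0 : 0 ≤ K := by positivity
      calc |F y / u y - 1| = |F y - u y| * u y / u y ^ 2 := by
            rw [div_sub_one hpos.ne', abs_div, abs_of_pos hpos]
            field_simp
        _ ≤ K / u y ^ 2 := by gcongr
        _ = K / c * (c / u y ^ 2) := by field_simp
        _ ≤ K / c * (F y / u y ^ 2) := by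
            have := hcF y
            gcongr
        _ = -(K / c * (-F y / u y ^ 2)) := by ring)
    (fun y hy => by
      have := hu1 y hy
      positivity)
    (by simpa using htop.inv_tendsto_atTop.const_mul (K / c))
  refine ⟨Real.exp l, Real.exp_pos l, ?_⟩
  refine ((Real.continuous_exp.tendsto l).comp hl).congr' ?_
  filter_upwards [eventually_ge_atTop (1 / c)] with y hy
  have hpos : 0 < u y := by linarith [hu1 y hy]
  rw [Function.comp_apply, sub_eq_neg_add, Real.exp_add, Real.exp_log hpos]
end

section
/- Let a > −2. Then there exist a function u : ℝ → ℝ solving u'(y)⁴ = 1 + a u(y)² + u(y)⁴ for all y, and functions ν, μ : [0,∞) → ℝ of class C^∞ with ν(t) > 0 for all t ≥ 0, such that for all y ∈ ℝ: u'(y) = e^{y} ν(e^{−2y}) = e^{−y} ν(e^{2y}), and u'(y)² (u''(y) − u(y)) = e^{−y} μ(e^{−2y}) = −e^{y} μ(e^{2y}). -/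
theorem hasDerivAt_integral_of_continuousOn_Ioi {b c x : ℝ} {h : ℝ → ℝ}
    (hh : ContinuousOn h (Set.Ioi b)) (hc : b < c) (hx : b < x) :
    HasDerivAt (fun y => ∫ s in c..y, h s) (h x) x := by
  refine intervalIntegral.integral_hasDerivAt_right ?_ ?_ ?_
  · refine (hh.mono fun s hs => ?_).intervalIntegrable
    exact (lt_min hc hx).trans_le hs.1
  · exact hh.stronglyMeasurableAtFilter isOpen_Ioi x hx
  · exact hh.continuousAt (Ioi_mem_nhds hx)

theorem contDiffOn_integral_Ioi {b c : ℝ} {h : ℝ → ℝ}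
    (hh : ContDiffOn ℝ (⊤ : ℕ∞) h (Set.Ioi b)) (hc : b < c) :
    ContDiffOn ℝ (⊤ : ℕ∞) (fun y => ∫ s in c..y, h s) (Set.Ioi b) := by
  have hd := fun x (hx : b < x) =>
    hasDerivAt_integral_of_continuousOn_Ioi hh.continuousOn hc hx
  rw [contDiffOn_infty_iff_deriv_of_isOpen isOpen_Ioi]
  exact ⟨fun x hx => (hd x hx).differentiableAt.differentiableWithinAt,
    hh.congr fun x hx => (hd x hx).deriv⟩

/-- A right inverse of a function with positive smooth derivative is smooth. -/
theorem contDiffOn_of_rightInverse {b : ℝ} {F F' T : ℝ → ℝ} {S : Set ℝ}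
    (hF : ContDiffOn ℝ (⊤ : ℕ∞) F (Set.Ioi b))
    (hd : ∀ x, b < x → HasDerivAt F (F' x) x) (hpos : ∀ x, b < x → 0 < F' x)
    (hT : ∀ t ∈ S, b < T t) (hFT : ∀ t ∈ S, F (T t) = t) :
    ContDiffOn ℝ (⊤ : ℕ∞) T S := by
  have hinj : Set.InjOn F (Set.Ioi b) := by
    refine (strictMonoOn_of_deriv_pos (convex_Ioi b) hF.continuousOn fun x hx => ?_).injOn
    rw [interior_Ioi] at hx
    rw [(hd x hx).deriv]
    exact hpos x hx
  intro t ht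
  have hFt : ContDiffAt ℝ (⊤ : ℕ∞) F (T t) := hF.contDiffAt (Ioi_mem_nhds (hT t ht))
  let e : ℝ ≃L[ℝ] ℝ := ContinuousLinearEquiv.unitsEquivAut ℝ
    (Units.mk0 (F' (T t)) (hpos _ (hT t ht)).ne')
  have hd' : HasFDerivAt F (e : ℝ →L[ℝ] ℝ) (T t) := by
    have he : (e : ℝ →L[ℝ] ℝ) = ContinuousLinearMap.toSpanSingleton ℝ (F' (T t)) := by
      ext
      simp [e]
    rw [he]
    exact (hd _ (hT t ht)).hasFDerivAt
  have hn : ((⊤ : ℕ∞) : WithTop ℕ∞) ≠ 0 := by simp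
  let L := hFt.localInverse hd' hn
  have hL : ContDiffAt ℝ (⊤ : ℕ∞) L t := by
    have := hFt.to_localInverse hd' hn
    rwa [hFT t ht] at this
  have hLt : L t = T t := by
    have := hFt.localInverse_apply_image hd' hn
    rwa [hFT t ht] at this
  have hright : ∀ᶠ s in nhds t, F (L s) = s := by
    have := (hFt.hasStrictFDerivAt' hd' hn).eventually_right_inverse
    rwa [hFT t ht] at this
  have hmem : ∀ᶠ s in nhds t, b < L s :=
    hL.continuousAt.eventually (lt_mem_nhds (by rw [hLt]; exact hT t ht))
  refine hL.contDiffWithinAt.congr_of_eventuallyEq ?_ hLt.symm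
  filter_upwards [nhdsWithin_le_nhds hright, nhdsWithin_le_nhds hmem, self_mem_nhdsWithin]
    with s h1 h2 h3
  exact hinj (hT s h3) h2 ((hFT s h3).trans h1.symm)

/-- If `h x⁻¹ = x² h x` and `1 + x h x > 0`, then for the primitive `H` of `h` vanishing at `1` the
function `x * exp (H x)` has a smooth inverse on `[0, ∞)`, which commutes with inversion. -/
theorem exists_smooth_inverse {b : ℝ} {h : ℝ → ℝ} (hb : b < 0)
    (hh : ContDiffOn ℝ (⊤ : ℕ∞) h (Set.Ioi b))
    (hpos : ∀ x, b < x → 0 < 1 + x * h x)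
    (hsymm : ∀ x, 0 < x → h x⁻¹ = x ^ 2 * h x) :
    ∃ H T : ℝ → ℝ, ContDiffOn ℝ (⊤ : ℕ∞) H (Set.Ioi b) ∧
      (∀ x, b < x → HasDerivAt H (h x) x) ∧
      ContDiffOn ℝ (⊤ : ℕ∞) T (Set.Ici 0) ∧
      (∀ t, 0 ≤ t → 0 ≤ T t) ∧ (∀ t, 0 < t → 0 < T t) ∧
      (∀ t, 0 ≤ t → T t * Real.exp (H (T t)) = t) ∧
      (∀ t, 0 < t → T t⁻¹ = (T t)⁻¹) := by
  let H : ℝ → ℝ := fun y => ∫ s in (1 : ℝ)..y, h s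
  have hb1 : b < 1 := by linarith
  have hHs : ContDiffOn ℝ (⊤ : ℕ∞) H (Set.Ioi b) := contDiffOn_integral_Ioi hh hb1
  have hHd : ∀ x, b < x → HasDerivAt H (h x) x := fun x hx =>
    hasDerivAt_integral_of_continuousOn_Ioi hh.continuousOn hb1 hx
  have hH1 : H 1 = 0 := by simp [H]
  let F : ℝ → ℝ := fun x => x * Real.exp (H x)
  have hF : ContDiffOn ℝ (⊤ : ℕ∞) F (Set.Ioi b) := contDiffOn_id.mul hHs.exp
  have hFd : ∀ x, b < x → HasDerivAt F ((1 + x * h x) * Real.exp (H x)) x := by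
    intro x hx
    refine ((hasDerivAt_id x).mul (hHd x hx).exp).congr_deriv ?_
    simp only [id]
    ring
  have hFd0 : ∀ x, b < x → 0 < (1 + x * h x) * Real.exp (H x) := fun x hx =>
    mul_pos (hpos x hx) (Real.exp_pos _)
  have hmono : StrictMonoOn F (Set.Ioi b) := by
    refine strictMonoOn_of_deriv_pos (convex_Ioi b) hF.continuousOn fun x hx => ?_
    rw [interior_Ioi] at hx
    rw [(hFd x hx).deriv]
    exact hFd0 x hx
  have hHinv : ∀ x, 0 < x → H x⁻¹ = -H x := by
    have hd : ∀ x ∈ Set.Ioi (0 : ℝ), HasDerivAt (fun x => H x⁻¹ + H x) 0 x := by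
      intro x hx
      have hx : 0 < x := hx
      have h1 := (hHd x⁻¹ (hb.trans (inv_pos.2 hx))).comp x (hasDerivAt_inv hx.ne')
      refine (h1.add (hHd x (hb.trans hx))).congr_deriv ?_
      rw [hsymm x hx]
      field_simp
      ring
    intro x hx
    have := isOpen_Ioi.is_const_of_deriv_eq_zero (convex_Ioi (0 : ℝ)).isPreconnected
      (fun x hx => (hd x hx).differentiableAt.differentiableWithinAt)
      (fun x hx => (hd x hx).deriv) (Set.mem_Ioi.2 hx) (Set.mem_Ioi.2 one_pos)
    simp only [inv_one, hH1] at this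
    linarith
  have hFinv : ∀ x, 0 < x → F x⁻¹ = (F x)⁻¹ := by
    intro x hx
    simp only [F, hHinv x hx, Real.exp_neg, mul_inv]
  have hF0 : F 0 = 0 := by simp [F]
  have hF1 : F 1 = 1 := by simp [F, hH1]
  have hsmall : ∀ t, 0 ≤ t → t ≤ 1 → ∃ x, 0 ≤ x ∧ F x = t := by
    intro t h0 h1
    have := intermediate_value_Icc (zero_le_one' ℝ)
      (hF.continuousOn.mono fun x hx => hb.trans_le hx.1)
    rw [hF0, hF1] at this
    obtain ⟨x, hx, hxt⟩ := this ⟨h0, h1⟩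
    exact ⟨x, hx.1, hxt⟩
  have hsurj : ∀ t, 0 ≤ t → ∃ x, 0 ≤ x ∧ F x = t := by
    intro t h0
    rcases le_total t 1 with h1 | h1
    · exact hsmall t h0 h1
    · obtain ⟨x, hx, hxt⟩ := hsmall t⁻¹ (inv_nonneg.2 h0) (inv_le_one_of_one_le₀ h1)
      have hx0 : 0 < x := hx.lt_of_ne fun h => by
        rw [← h, hF0] at hxt
        have := inv_pos.2 (one_pos.trans_le h1)
        linarith
      exact ⟨x⁻¹, inv_nonneg.2 hx, by rw [hFinv x hx0, hxt, inv_inv]⟩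
  choose! T hT0 hFT using hsurj
  have hTpos : ∀ t, 0 < t → 0 < T t := fun t ht => (hT0 t ht.le).lt_of_ne fun h => by
    have := hFT t ht.le
    rw [← h, hF0] at this
    exact ht.ne this
  refine ⟨H, T, hHs, hHd, ?_, hT0, hTpos, hFT, fun t ht => ?_⟩
  · exact contDiffOn_of_rightInverse hF hFd hFd0 (fun t ht => hb.trans_le (hT0 t ht)) hFT
  · have ht' := inv_pos.2 ht
    refine hmono.injOn (hb.trans (hTpos _ ht')) (hb.trans (inv_pos.2 (hTpos t ht))) ?_
    rw [hFT _ ht'.le, hFinv _ (hTpos t ht), hFT t ht.le]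

/-- The value of `1 + a u² + u⁴`, divided by `cosh⁴ z`, at `u = sinh z`, `x = e^{-2z}`. -/
noncomputable def quarticRatio (a x : ℝ) : ℝ := 1 + (a - 2) * (4 * x * (1 - x) ^ 2 / (1 + x) ^ 4)

/-- The positive fourth root of `quarticRatio`. -/
noncomputable def speed (a x : ℝ) : ℝ := √(√(quarticRatio a x))

theorem quarticRatio_pos {a x : ℝ} (ha : -2 < a) (hx : 0 ≤ x) : 0 < quarticRatio a x := by
  have h1 : 0 < 1 + x := by linarith
  have h : quarticRatio a x =
      (((1 + x) ^ 2 - 2 * (1 - x) ^ 2) ^ 2 + (a + 2) * (4 * x * (1 - x) ^ 2)) / (1 + x) ^ 4 := by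
    unfold quarticRatio
    field_simp
    ring
  rw [h]
  refine div_pos ?_ (by positivity)
  have h2 : 0 < a + 2 := by linarith
  rcases hx.eq_or_lt with rfl | hx
  · norm_num
  · by_cases hx1 : x = 1
    · subst hx1
      norm_num
    · have : 0 < (1 - x) ^ 2 := by
        have : 1 - x ≠ 0 := sub_ne_zero.2 (Ne.symm hx1)
        positivity
      positivity

theorem exists_neg_quarticRatio_pos {a : ℝ} (ha : -2 < a) :
    ∃ b : ℝ, b < 0 ∧ -1 < b ∧ ∀ x, b < x → 0 < quarticRatio a x := by
  have hc : ContinuousAt (quarticRatio a) 0 := by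
    unfold quarticRatio
    refine ContinuousAt.add continuousAt_const (continuousAt_const.mul ?_)
    exact ContinuousAt.div (by fun_prop) (by fun_prop) (by norm_num)
  obtain ⟨ε, hε, h⟩ := Metric.eventually_nhds_iff.1
    (hc.eventually (lt_mem_nhds (quarticRatio_pos ha le_rfl)))
  refine ⟨-min ε (1 / 2), by simp [hε], ?_, fun x hx => ?_⟩
  · have := min_le_right ε (1 / 2)
    linarith
  · rcases le_or_gt 0 x with h0 | h0
    · exact quarticRatio_pos ha h0
    · refine h ?_
      have := min_le_left ε (1 / 2)
      rw [Real.dist_eq, sub_zero, abs_of_neg h0]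
      linarith

theorem speed_pos {a x : ℝ} (h : 0 < quarticRatio a x) : 0 < speed a x :=
  Real.sqrt_pos.2 (Real.sqrt_pos.2 h)

theorem speed_pow_four {a x : ℝ} (h : 0 < quarticRatio a x) :
    speed a x ^ 4 = quarticRatio a x := by
  rw [show 4 = 2 * 2 from rfl, pow_mul, speed, Real.sq_sqrt (Real.sqrt_nonneg _),
    Real.sq_sqrt h.le]

theorem contDiffOn_speed {a b : ℝ} (hb : -1 < b) (h : ∀ x, b < x → 0 < quarticRatio a x) :
    ContDiffOn ℝ (⊤ : ℕ∞) (speed a) (Set.Ioi b) := by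
  have hq : ContDiffOn ℝ (⊤ : ℕ∞) (quarticRatio a) (Set.Ioi b) := by
    unfold quarticRatio
    refine contDiffOn_const.add (contDiffOn_const.mul ?_)
    refine ContDiffOn.div (by fun_prop) (by fun_prop) fun x hx => ?_
    have : 0 < 1 + x := by linarith [Set.mem_Ioi.1 hx]
    positivity
  exact (hq.sqrt fun x hx => (h x hx).ne').sqrt fun x hx => (Real.sqrt_pos.2 (h x hx)).ne'

theorem speed_inv (a : ℝ) {x : ℝ} (hx : 0 < x) : speed a x⁻¹ = speed a x := by
  have : quarticRatio a x⁻¹ = quarticRatio a x := by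
    unfold quarticRatio
    have : 0 < 1 + x := by linarith
    have : 0 < x + 1 := by linarith
    have h : 1 + x⁻¹ = (1 + x) / x := by field_simp; ring
    have h' : 1 - x⁻¹ = -((1 - x) / x) := by field_simp; ring
    rw [h, h']
    field_simp
  rw [speed, this, speed]

/-- The function `(1 / speed - 1) / x`, written without a singularity at `x = 0`. -/
noncomputable def speedDefect (a x : ℝ) : ℝ :=
  -(a - 2) * (4 * (1 - x) ^ 2) /
    ((1 + x) ^ 4 * (speed a x * (1 + speed a x) * (1 + speed a x ^ 2)))

theorem one_add_mul_speedDefect {a x : ℝ} (hx : -1 < x) (h : 0 < quarticRatio a x) :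
    1 + x * speedDefect a x = (speed a x)⁻¹ := by
  have hr := speed_pos h
  have hr4 := speed_pow_four h
  unfold speedDefect
  have h1 : 0 < 1 + x := by linarith
  set r := speed a x
  have hq : r ^ 4 * (1 + x) ^ 4 = (1 + x) ^ 4 + (a - 2) * (4 * x * (1 - x) ^ 2) := by
    rw [hr4, quarticRatio]
    field_simp
  field_simp
  linear_combination hq

theorem contDiffOn_speedDefect {a b : ℝ} (hb : -1 < b)
    (h : ∀ x, b < x → 0 < quarticRatio a x) :
    ContDiffOn ℝ (⊤ : ℕ∞) (speedDefect a) (Set.Ioi b) := by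
  have hr := contDiffOn_speed hb h
  unfold speedDefect
  refine ContDiffOn.div (by fun_prop) (by fun_prop) fun x hx => ?_
  have h1 : 0 < 1 + x := by linarith [Set.mem_Ioi.1 hx]
  have h2 := speed_pos (h x hx)
  positivity

theorem speedDefect_inv (a : ℝ) {x : ℝ} (hx : 0 < x) :
    speedDefect a x⁻¹ = x ^ 2 * speedDefect a x := by
  unfold speedDefect
  rw [speed_inv a hx]
  have h1 : 0 < 1 + x := by linarith
  have h : 1 + x⁻¹ = (1 + x) / x := by field_simp; ring
  have h' : 1 - x⁻¹ = -((1 - x) / x) := by field_simp; ring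
  rw [h, h']
  field_simp

theorem quartic_eq {a w r : ℝ} (hw : 0 < w) (hr : r ^ 4 = quarticRatio a (w ^ 2)) :
    (r * (w⁻¹ + w) / 2) ^ 4 = 1 + a * ((w⁻¹ - w) / 2) ^ 2 + ((w⁻¹ - w) / 2) ^ 4 := by
  have h1 : (r * (w⁻¹ + w) / 2) ^ 4 = r ^ 4 * ((w⁻¹ + w) / 2) ^ 4 := by ring
  rw [h1, hr, quarticRatio]
  field_simp
  ring

theorem half_add_sq_sub_sq {a x r : ℝ} (hx : 0 < x) (hr : r ^ 4 = quarticRatio a x) :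
    a / 2 + (1 - x) ^ 2 / (4 * x) - r ^ 2 * (1 + x) ^ 2 / (4 * x) =
      x * ((a - 2) / (2 * (1 + r ^ 2)) *
        (4 * (a - 2) * (1 - x) ^ 2 / ((1 + x) ^ 4 * (1 + r ^ 2)) + 8 / (1 + x) ^ 2)) := by
  have h1 : 0 < 1 + x := by linarith
  have hq : r ^ 4 * (1 + x) ^ 4 = (1 + x) ^ 4 + (a - 2) * (4 * x * (1 - x) ^ 2) := by
    rw [hr, quarticRatio]
    field_simp
  have hB : 4 * (a - 2) * (1 - x) ^ 2 / ((1 + x) ^ 4 * (1 + r ^ 2)) = (r ^ 2 - 1) / x := by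
    field_simp
    linear_combination -hq
  rw [hB]
  field_simp
  linear_combination -2 * hq

theorem deriv_sq_mul_iteratedDeriv_two {a : ℝ} {u : ℝ → ℝ} {y : ℝ}
    (hu : ∀ y, deriv u y ^ 4 = 1 + a * u y ^ 2 + u y ^ 4) (hd : DifferentiableAt ℝ u y)
    (hd' : DifferentiableAt ℝ (deriv u) y) (h0 : deriv u y ≠ 0) :
    deriv u y ^ 2 * iteratedDeriv 2 u y = a / 2 * u y + u y ^ 3 := by
  have h1 := hd'.hasDerivAt.pow 4
  have h2 := ((hd.hasDerivAt.pow 2).const_mul a).const_add 1 |>.add (hd.hasDerivAt.pow 4)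
  have h3 := h1.unique (h2.congr_of_eventuallyEq (Filter.Eventually.of_forall fun y => hu y))
  have h4 : iteratedDeriv 2 u y = deriv (deriv u) y := by
    rw [iteratedDeriv_succ, iteratedDeriv_one]
  rw [h4]
  refine mul_left_cancel₀ h0 ?_
  norm_num at h3
  linear_combination h3 / 4


/-- For `a > −2` there exist a solution `u` of
`u'⁴ = 1 + a u² + u⁴` on `ℝ` and `C^∞` functions `ν, μ` on `[0,∞)` with
`ν > 0`, such that `u'(y) = e^y ν(e^{−2y}) = e^{−y} ν(e^{2y})` and
`u'(y)² (u''(y) − u(y)) = e^{−y} μ(e^{−2y}) = −e^y μ(e^{2y})` for all `y`. -/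
theorem smooth_structure_of_solution (a : ℝ) (ha : -2 < a) :
    ∃ u ν μ : ℝ → ℝ,
      (∀ y : ℝ, (deriv u y) ^ 4 = 1 + a * (u y) ^ 2 + (u y) ^ 4) ∧
      ContDiffOn ℝ (⊤ : ℕ∞) ν (Set.Ici 0) ∧
      ContDiffOn ℝ (⊤ : ℕ∞) μ (Set.Ici 0) ∧
      (∀ t : ℝ, 0 ≤ t → 0 < ν t) ∧
      (∀ y : ℝ,
        deriv u y = Real.exp y * ν (Real.exp (-2 * y)) ∧
        deriv u y = Real.exp (-y) * ν (Real.exp (2 * y)) ∧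
        (deriv u y) ^ 2 * (iteratedDeriv 2 u y - u y)
          = Real.exp (-y) * μ (Real.exp (-2 * y)) ∧
        (deriv u y) ^ 2 * (iteratedDeriv 2 u y - u y)
          = -(Real.exp y * μ (Real.exp (2 * y)))) := by
  obtain ⟨b, hb, hb1, hq⟩ := exists_neg_quarticRatio_pos ha
  have hpos : ∀ x, b < x → 0 < 1 + x * speedDefect a x := fun x hx => by
    rw [one_add_mul_speedDefect (hb1.trans hx) (hq x hx)]
    exact inv_pos.2 (speed_pos (hq x hx))
  obtain ⟨H, T, hHs, hHd, hTs, hT0, hTpos, hFT, hTinv⟩ := exists_smooth_inverse hb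
    (contDiffOn_speedDefect hb1 hq) hpos fun x hx => speedDefect_inv a hx
  have hTmaps : Set.MapsTo T (Set.Ici 0) (Set.Ioi b) := fun t ht => hb.trans_le (hT0 t ht)
  have hrT : ContDiffOn ℝ (⊤ : ℕ∞) (fun t => speed a (T t)) (Set.Ici 0) :=
    (contDiffOn_speed hb1 hq).comp hTs hTmaps
  have hHT : ContDiffOn ℝ (⊤ : ℕ∞) (fun t => H (T t)) (Set.Ici 0) := hHs.comp hTs hTmaps
  have hr : ∀ t, 0 ≤ t → 0 < speed a (T t) := fun t ht => speed_pos (hq _ (hTmaps ht))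
  have hr4 : ∀ t, 0 ≤ t → speed a (T t) ^ 4 = quarticRatio a (T t) := fun t ht =>
    speed_pow_four (hq _ (hTmaps ht))
  have hTd : ∀ t, 0 < t → HasDerivAt T (speed a (T t) * Real.exp (-H (T t))) t := by
    intro t ht
    have hd := (hTs.contDiffAt (Ici_mem_nhds ht)).differentiableAt (by simp) |>.hasDerivAt
    have hbT := hTmaps ht.le
    have h1 := hd.mul ((hHd _ hbT).comp t hd).exp
    have h2 := h1.unique ((hasDerivAt_id t).congr_of_eventuallyEq <| by
      filter_upwards [Ioi_mem_nhds ht] with s hs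
      exact hFT s (le_of_lt hs))
    refine hd.congr_deriv ?_
    have h3 := one_add_mul_speedDefect (hb1.trans hbT) (hq _ hbT)
    have h4 : deriv T t * ((speed a (T t))⁻¹ * Real.exp (H (T t))) = 1 := by
      rw [← h3]
      refine Eq.trans ?_ h2
      simp only [Function.comp]
      ring
    have := hr t ht.le
    rw [Real.exp_neg]
    field_simp at h4 ⊢
    exact h4
  let w : ℝ → ℝ := fun y => √(T (Real.exp (-2 * y)))
  have hwpos : ∀ y, 0 < w y := fun y => Real.sqrt_pos.2 (hTpos _ (Real.exp_pos _))
  have hw2 : ∀ y, w y ^ 2 = T (Real.exp (-2 * y)) := fun y =>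
    Real.sq_sqrt (hT0 _ (Real.exp_pos _).le)
  have hwd : ∀ y, HasDerivAt w (-(speed a (T (Real.exp (-2 * y))) * w y)) y := by
    intro y
    have h1 : HasDerivAt (fun y : ℝ => Real.exp (-2 * y)) (Real.exp (-2 * y) * (-2)) y :=
      ((hasDerivAt_const_mul (-2 : ℝ)).exp)
    have h2 := ((hTd _ (Real.exp_pos (-2 * y))).comp y h1).sqrt (hTpos _ (Real.exp_pos _)).ne'
    refine h2.congr_deriv ?_
    have h3 := hFT _ (Real.exp_pos (-2 * y)).le
    have h4 := hwpos y
    have h5 := hw2 y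
    change _ / (2 * w y) = _
    rw [Real.exp_neg]
    rw [← h5] at h3 ⊢
    generalize Real.exp (-2 * y) = t at h3 ⊢
    field_simp
    linear_combination speed a (w y ^ 2) * h3
  have hwE : ∀ y, w y * Real.exp (H (T (Real.exp (-2 * y))) / 2) = Real.exp (-y) := by
    intro y
    rw [← sq_eq_sq₀ (by have := hwpos y; positivity) (by positivity), mul_pow, hw2,
      ← Real.exp_nat_mul, ← Real.exp_nat_mul, Nat.cast_ofNat, mul_div_cancel₀ _ two_ne_zero,
      show 2 * -y = -2 * y by ring]
    exact hFT _ (Real.exp_pos (-2 * y)).le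
  have hwneg : ∀ y, w (-y) = (w y)⁻¹ := by
    intro y
    have : Real.exp (-2 * -y) = (Real.exp (-2 * y))⁻¹ := by
      rw [← Real.exp_neg]
      congr 1
      ring
    simp only [w]
    rw [this, hTinv _ (Real.exp_pos _), Real.sqrt_inv]
  let u : ℝ → ℝ := fun y => ((w y)⁻¹ - w y) / 2
  have hud : ∀ y, HasDerivAt u
      (speed a (T (Real.exp (-2 * y))) * ((w y)⁻¹ + w y) / 2) y := by
    intro y
    refine ((((hwd y).inv (hwpos y).ne').sub (hwd y)).div_const 2).congr_deriv ?_
    have := hwpos y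
    field_simp
    ring
  have huneg : ∀ y, u (-y) = -u y := by
    intro y
    simp only [u, hwneg, inv_inv]
    ring
  have hu4 : ∀ y, deriv u y ^ 4 = 1 + a * u y ^ 2 + u y ^ 4 := by
    intro y
    rw [(hud y).deriv]
    refine quartic_eq (hwpos y) ?_
    rw [hw2, hr4 _ (Real.exp_pos _).le]
  let ν : ℝ → ℝ := fun t => Real.exp (H (T t) / 2) * speed a (T t) * (1 + T t) / 2
  let μ : ℝ → ℝ := fun t => Real.exp (-(H (T t) / 2)) * ((1 - T t) / 2) *
    ((a - 2) / (2 * (1 + speed a (T t) ^ 2)) *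
      (4 * (a - 2) * (1 - T t) ^ 2 / ((1 + T t) ^ 4 * (1 + speed a (T t) ^ 2))
        + 8 / (1 + T t) ^ 2))
  have hνs : ContDiffOn ℝ (⊤ : ℕ∞) ν (Set.Ici 0) :=
    (((hHT.div_const 2).exp.mul hrT).mul (contDiffOn_const.add hTs)).div_const 2
  have hμs : ContDiffOn ℝ (⊤ : ℕ∞) μ (Set.Ici 0) := by
    have h1 : ∀ t ∈ Set.Ici (0 : ℝ), 0 < 1 + T t := fun t ht => by
      linarith [hT0 t ht]
    refine ContDiffOn.mul ((hHT.div_const 2).neg.exp.mul (by fun_prop)) (ContDiffOn.mul ?_ (ContDiffOn.add ?_ ?_))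
    · exact ContDiffOn.div (by fun_prop) (by fun_prop) fun t ht => by positivity
    · exact ContDiffOn.div (by fun_prop) (by fun_prop) fun t ht => by
        have := h1 t ht
        positivity
    · exact ContDiffOn.div (by fun_prop) (by fun_prop) fun t ht => by
        have := h1 t ht
        positivity
  have hνpos : ∀ t, 0 ≤ t → 0 < ν t := fun t ht => by
    have := hr t ht
    have := hT0 t ht
    positivity
  have huν : ∀ y, deriv u y = Real.exp y * ν (Real.exp (-2 * y)) := by
    intro y
    have h1 : Real.exp y = (Real.exp (-y))⁻¹ := by rw [Real.exp_neg, inv_inv]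
    rw [(hud y).deriv, h1, ← hwE]
    simp only [ν]
    rw [← hw2]
    have := hwpos y
    field_simp
  have hud' : ∀ y, DifferentiableAt ℝ (deriv u) y := by
    intro y
    rw [funext huν]
    refine Real.differentiableAt_exp.mul ?_
    have h1 : DifferentiableAt ℝ ν (Real.exp (-2 * y)) :=
      (hνs.contDiffAt (Ici_mem_nhds (Real.exp_pos _))).differentiableAt (by simp)
    exact h1.comp (f := fun y => Real.exp (-2 * y)) y (by fun_prop)
  have huμ : ∀ y, deriv u y ^ 2 * (iteratedDeriv 2 u y - u y)
      = Real.exp (-y) * μ (Real.exp (-2 * y)) := by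
    intro y
    have h0 : deriv u y ≠ 0 := by
      rw [huν]
      exact (mul_pos (Real.exp_pos _) (hνpos _ (Real.exp_pos _).le)).ne'
    rw [mul_sub, deriv_sq_mul_iteratedDeriv_two hu4 (hud y).differentiableAt (hud' y) h0,
      (hud y).deriv, ← hwE]
    simp only [μ]
    have h1 := half_add_sq_sub_sq (hTpos _ (Real.exp_pos _)) (hr4 _ (Real.exp_pos (-2 * y)).le)
    rw [Real.exp_neg]
    set E := Real.exp (H (T (Real.exp (-2 * y))) / 2)
    have hE0 : E ≠ 0 := (Real.exp_pos _).ne'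
    set r := speed a (T (Real.exp (-2 * y)))
    rw [← hw2] at h1 ⊢
    generalize (a - 2) / (2 * (1 + r ^ 2)) * (4 * (a - 2) * (1 - (w y) ^ 2) ^ 2 /
      ((1 + (w y) ^ 2) ^ 4 * (1 + r ^ 2)) + 8 / (1 + (w y) ^ 2) ^ 2) = X at h1 ⊢
    simp only [u]
    have := hwpos y
    field_simp at h1 ⊢
    linear_combination (1 - w y ^ 2) / 2 * h1
  have hev : ∀ y, deriv u (-y) = deriv u y := by
    intro y
    have h1 := deriv_comp_neg u y
    rw [funext huneg, deriv.fun_neg] at h1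
    linarith
  have hodd : ∀ y, iteratedDeriv 2 u (-y) = -iteratedDeriv 2 u y := by
    intro y
    have h1 := deriv_comp_neg (deriv u) y
    rw [funext hev] at h1
    rw [iteratedDeriv_succ, iteratedDeriv_one]
    linarith
  refine ⟨u, ν, μ, hu4, hνs, hμs, hνpos, fun y => ⟨huν y, ?_, huμ y, ?_⟩⟩
  · have := huν (-y)
    rwa [hev, neg_mul_neg] at this
  · have := huμ (-y)
    rw [hev, hodd, huneg, neg_mul_neg, neg_neg] at this
    linarith
end

section
/- Let a > −2 and let u : ℝ → ℝ be a surjective, twice differentiable function with u'(y) > 0 and u'(y)⁴ = 1 + a u(y)² + u(y)⁴ for all y ∈ ℝ. If u''(y) − u(y) is constant in y, then a = 2 and the constant equals 0. -/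
/-- If `a > −2` and `u : ℝ → ℝ` is a surjective, twice
differentiable function with `u' > 0` and `u'⁴ = 1 + a u² + u⁴` everywhere,
and if `u'' − u` is constant, then `a = 2` and the constant is `0`. -/
theorem rigidity_constant_potential (a : ℝ) (ha : -2 < a) (u : ℝ → ℝ)
    (hsurj : Function.Surjective u)
    (hdiff : Differentiable ℝ u)
    (hdiff2 : Differentiable ℝ (deriv u))
    (hu' : ∀ y : ℝ, 0 < deriv u y)
    (hode : ∀ y : ℝ, (deriv u y) ^ 4 = 1 + a * (u y) ^ 2 + (u y) ^ 4)
    (c : ℝ) (hc : ∀ y : ℝ, iteratedDeriv 2 u y - u y = c) :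
    a = 2 ∧ c = 0 := by
  have key : ∀ y : ℝ, 2 * (deriv u y) ^ 2 * (u y + c) = a * u y + 2 * (u y) ^ 3 := by
    intro y
    have hu : HasDerivAt u (deriv u y) y := (hdiff y).hasDerivAt
    have hu2 : HasDerivAt (deriv u) (u y + c) y := by
      have h := (hdiff2 y).hasDerivAt
      have hcy := hc y
      rw [iteratedDeriv_succ, iteratedDeriv_one] at hcy
      rwa [show deriv (deriv u) y = u y + c by linarith] at h
    have hl := hu2.fun_pow 4
    have hr := (((hu.fun_pow 2).const_mul a).const_add 1).fun_add (hu.fun_pow 4)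
    rw [funext hode] at hl
    have h := hl.unique hr
    norm_num at h
    apply mul_left_cancel₀ (hu' y).ne'
    linear_combination h / 2
  obtain ⟨y₀, h₀⟩ := hsurj 0
  obtain ⟨y₁, h₁⟩ := hsurj 1
  have hc0 : c = 0 := by
    have h := key y₀
    rw [h₀] at h
    have hp : 2 * (deriv u y₀) ^ 2 ≠ 0 := by
      have := hu' y₀
      positivity
    exact (mul_eq_zero.mp (by linear_combination h)).resolve_left hp
  refine ⟨?_, hc0⟩
  have h := key y₁
  have ho := hode y₁
  rw [h₁, hc0] at h
  rw [h₁] at ho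
  have hprod : (a + 2) * (a - 2) = 0 := by
    linear_combination -(2 * deriv u y₁ ^ 2 + (a + 2)) * h + 4 * ho
  have := (mul_eq_zero.mp hprod).resolve_left (by linarith)
  linarith
end

section
/- Define Ψ : (0,∞) → ℝ by Ψ(u) = √(1 + u²) − u. Then for every u > 0 one has 0 < Ψ(u) < 1, and for all real numbers P, Q and all φ ∈ ℝ: ( Ψ'(u) cos φ · P − Ψ(u) sin φ · Q )² + ( Ψ'(u) sin φ · P + Ψ(u) cos φ · Q )² + 2 ( Ψ(u) Ψ'(u) / √(1 − Ψ(u)²) )² P² = Ψ(u)² ( Q² + P² / ( u √(1 + u²) ) ). -/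
open Real

/-- The function `√(1 + u²) − u` satisfies `Ψ' = -Ψ / √(1 + u²)`. -/
theorem hasDerivAt_sqrt_one_add_sq_sub (u : ℝ) :
    HasDerivAt (fun v : ℝ => √(1 + v ^ 2) - v) (-(√(1 + u ^ 2) - u) / √(1 + u ^ 2)) u := by
  have hpos : 0 < 1 + u ^ 2 := by positivity
  have hs : √(1 + u ^ 2) ≠ 0 := (Real.sqrt_pos.2 hpos).ne'
  have h := ((((hasDerivAt_id u).pow 2).const_add 1).sqrt hpos.ne').sub (hasDerivAt_id u)
  refine h.congr_deriv ?_
  simp only [id, Pi.pow_apply]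
  field_simp
  push_cast
  ring

/-- For `Ψ u = √(1 + u²) − u` one has `0 < Ψ u < 1` for `u > 0`,
together with the quadratic-form identity
`(Ψ' cos φ · P − Ψ sin φ · Q)² + (Ψ' sin φ · P + Ψ cos φ · Q)²
  + 2 (Ψ Ψ'/√(1 − Ψ²))² P² = Ψ² (Q² + P²/(u √(1 + u²)))`. -/
theorem kovalevskaya_change_of_variables
    (Ψ : ℝ → ℝ) (hΨ : ∀ u : ℝ, Ψ u = Real.sqrt (1 + u ^ 2) - u) :
    ∀ u : ℝ, 0 < u →
      (0 < Ψ u ∧ Ψ u < 1) ∧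
      ∀ P Q φ : ℝ,
        (deriv Ψ u * Real.cos φ * P - Ψ u * Real.sin φ * Q) ^ 2
          + (deriv Ψ u * Real.sin φ * P + Ψ u * Real.cos φ * Q) ^ 2
          + 2 * (Ψ u * deriv Ψ u / Real.sqrt (1 - (Ψ u) ^ 2)) ^ 2 * P ^ 2
        = (Ψ u) ^ 2 * (Q ^ 2 + P ^ 2 / (u * Real.sqrt (1 + u ^ 2))) := by
  intro u hu
  have hderiv : deriv Ψ u = -Ψ u / √(1 + u ^ 2) := by
    rw [hΨ u, funext hΨ]
    exact (hasDerivAt_sqrt_one_add_sq_sub u).deriv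
  have hsq : √(1 + u ^ 2) ^ 2 = 1 + u ^ 2 := Real.sq_sqrt (by positivity)
  have hs : 0 < √(1 + u ^ 2) := Real.sqrt_pos.2 (by positivity)
  have hΨu := hΨ u
  rw [hderiv]
  generalize √(1 + u ^ 2) = s at *
  generalize Ψ u = y at *
  have hy : 0 < y := by nlinarith
  have hy1 : y < 1 := by nlinarith
  refine ⟨⟨hy, hy1⟩, fun P Q φ => ?_⟩
  have hone : 1 - y ^ 2 = 2 * u * y := by subst hΨu; linear_combination -hsq
  have hroot : √(1 - y ^ 2) ^ 2 = 2 * u * y := by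
    rw [Real.sq_sqrt (by rw [hone]; positivity), hone]
  have hthird : (y * (-y / s) / √(1 - y ^ 2)) ^ 2 = y ^ 3 / (2 * u * s ^ 2) := by
    rw [div_pow, hroot]
    field_simp
  have hcoeff : (y / s) ^ 2 + 2 * (y ^ 3 / (2 * u * s ^ 2)) = y ^ 2 / (u * s) := by
    field_simp
    linear_combination hΨu
  rw [hthird]
  linear_combination ((y / s) ^ 2 * P ^ 2 + y ^ 2 * Q ^ 2) * Real.sin_sq_add_cos_sq φ
    + P ^ 2 * hcoeff
end

section
/- Let a > −2 and let u : ℝ → ℝ be the unique global solution of u' = (1 + a u² + u⁴)^{1/4} with u(0) = 0. Consider the Hamiltonian H : ℝ⁴ → ℝ, H(φ, y, p_φ, p_y) = u'(y)² (p_φ² + p_y²) − (u''(y) − u(y)) u'(y)² cos φ. Then H possesses an integral of fourth degree in momenta: there exist C^∞ functions a_{jk} : ℝ² → ℝ for j + k ≤ 4 such that F(φ, y, p_φ, p_y) = Σ_{j+k≤4} a_{jk}(φ,y) p_φ^j p_y^k satisfies {F, H} = 0 everywhere, and the differentials of F and H are linearly independent at some point of ℝ⁴. -/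
/-- The canonical Poisson bracket of two functions on `ℝ⁴` with coordinates
`(q₁, q₂, p₁, p₂)`, evaluated at a point. -/
noncomputable def pbracket (F H : ℝ × ℝ × ℝ × ℝ → ℝ) (v : ℝ × ℝ × ℝ × ℝ) : ℝ :=
  deriv (fun t => F (t, v.2.1, v.2.2.1, v.2.2.2)) v.1 *
      deriv (fun t => H (v.1, v.2.1, t, v.2.2.2)) v.2.2.1
    + deriv (fun t => F (v.1, t, v.2.2.1, v.2.2.2)) v.2.1 *
      deriv (fun t => H (v.1, v.2.1, v.2.2.1, t)) v.2.2.2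
    - deriv (fun t => F (v.1, v.2.1, t, v.2.2.2)) v.2.2.1 *
      deriv (fun t => H (t, v.2.1, v.2.2.1, v.2.2.2)) v.1
    - deriv (fun t => F (v.1, v.2.1, v.2.2.1, t)) v.2.2.2 *
      deriv (fun t => H (v.1, t, v.2.2.1, v.2.2.2)) v.2.1

/-- `H` possesses an integral of fourth degree in the momenta: a function
`F = Σ_{j+k≤4} a_{jk}(q₁,q₂) p₁^j p₂^k` with `C^∞` coefficients, Poisson
commuting with `H`, whose differential is linearly independent from that of
`H` at some point. -/
def HasQuarticIntegral (H : ℝ × ℝ × ℝ × ℝ → ℝ) : Prop :=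
  ∃ A : ℕ → ℕ → (ℝ × ℝ → ℝ),
    (∀ j k : ℕ, j + k ≤ 4 → ContDiff ℝ (⊤ : ℕ∞) (A j k)) ∧
    ∃ F : ℝ × ℝ × ℝ × ℝ → ℝ,
      (∀ v : ℝ × ℝ × ℝ × ℝ,
        F v = ∑ jk ∈ Finset.filter (fun jk => jk.1 + jk.2 ≤ 4)
            (Finset.range 5 ×ˢ Finset.range 5),
          A jk.1 jk.2 (v.1, v.2.1) * v.2.2.1 ^ jk.1 * v.2.2.2 ^ jk.2) ∧
      (∀ v : ℝ × ℝ × ℝ × ℝ, pbracket F H v = 0) ∧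
      ∃ v : ℝ × ℝ × ℝ × ℝ,
        LinearIndependent ℝ ![fderiv ℝ F v, fderiv ℝ H v]

/-- A solution of an autonomous ODE `u' = g(u)` with smooth right-hand side is smooth. -/
theorem contDiff_of_hasDerivAt_comp {g u : ℝ → ℝ} (hg : ContDiff ℝ (⊤ : ℕ∞) g)
    (hu : ∀ y, HasDerivAt u (g (u y)) y) : ContDiff ℝ (⊤ : ℕ∞) u := by
  have hd : deriv u = fun y => g (u y) := funext fun y => (hu y).deriv
  refine contDiff_infty.2 fun n => ?_
  induction n with
  | zero =>
    exact contDiff_zero.2 (continuous_iff_continuousAt.2 fun y => (hu y).continuousAt)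
  | succ n ih =>
    push_cast
    refine contDiff_succ_iff_deriv.2 ⟨fun y => (hu y).differentiableAt, by simp, ?_⟩
    rw [hd]
    exact (hg.of_le (by exact_mod_cast le_top)).comp ih

theorem one_add_mul_sq_add_pow_four_pos {a : ℝ} (ha : -2 < a) (x : ℝ) :
    0 < 1 + a * x ^ 2 + x ^ 4 := by
  rcases eq_or_ne x 0 with rfl | hx
  · norm_num
  · nlinarith [sq_nonneg (1 - x ^ 2), mul_pos (by linarith : 0 < a + 2) (sq_pos_of_ne_zero hx)]

/-- The coefficients of the quartic integral, in terms of the solution `u` and its derivative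
`v`. -/
noncomputable def quarticCoeff (a : ℝ) (u v : ℝ → ℝ) : ℕ → ℕ → ℝ × ℝ → ℝ
  | 4, 0 => fun _ => 1
  | 2, 0 => fun x => 2 * u x.2 * Real.cos x.1
  | 1, 1 => fun x => -2 * v x.2 * Real.sin x.1
  | 0, 0 => fun x => ((u x.2 ^ 2 - v x.2 ^ 2) / 2 + a / 4) * Real.sin x.1 ^ 2
  | _, _ => fun _ => 0

theorem contDiff_quarticCoeff (a : ℝ) {u v : ℝ → ℝ} (hu : ContDiff ℝ (⊤ : ℕ∞) u)
    (hv : ContDiff ℝ (⊤ : ℕ∞) v) (j k : ℕ) :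
    ContDiff ℝ (⊤ : ℕ∞) (quarticCoeff a u v j k) := by
  unfold quarticCoeff
  split <;> fun_prop

/-- The quartic integral. -/
noncomputable def quarticIntegral (a : ℝ) (u v : ℝ → ℝ) (x : ℝ × ℝ × ℝ × ℝ) : ℝ :=
  x.2.2.1 ^ 4 + 2 * u x.2.1 * Real.cos x.1 * x.2.2.1 ^ 2
    - 2 * v x.2.1 * Real.sin x.1 * x.2.2.1 * x.2.2.2
    + ((u x.2.1 ^ 2 - v x.2.1 ^ 2) / 2 + a / 4) * Real.sin x.1 ^ 2

theorem quarticIntegral_eq_sum (a : ℝ) (u v : ℝ → ℝ) (x : ℝ × ℝ × ℝ × ℝ) :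
    quarticIntegral a u v x =
      ∑ jk ∈ Finset.filter (fun jk => jk.1 + jk.2 ≤ 4) (Finset.range 5 ×ˢ Finset.range 5),
        quarticCoeff a u v jk.1 jk.2 (x.1, x.2.1) * x.2.2.1 ^ jk.1 * x.2.2.2 ^ jk.2 := by
  simp only [Finset.sum_filter, Finset.sum_product, Finset.sum_range_succ, Finset.sum_range_zero]
  simp [quarticCoeff, quarticIntegral]
  ring

/-- The Hamiltonian with `v`, `w` in place of the first two derivatives of `u`. -/
noncomputable def sphereHamiltonian (u v w : ℝ → ℝ) (x : ℝ × ℝ × ℝ × ℝ) : ℝ :=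
  v x.2.1 ^ 2 * (x.2.2.1 ^ 2 + x.2.2.2 ^ 2)
    - (w x.2.1 - u x.2.1) * v x.2.1 ^ 2 * Real.cos x.1

section Derivatives

variable {a : ℝ} {u v w : ℝ → ℝ} (q y p r : ℝ)

theorem hasDerivAt_quarticIntegral_angle :
    HasDerivAt (fun t => quarticIntegral a u v (t, y, p, r))
      (-2 * u y * Real.sin q * p ^ 2 - 2 * v y * Real.cos q * p * r
        + ((u y ^ 2 - v y ^ 2) / 2 + a / 4) * (2 * Real.sin q * Real.cos q)) q := by
  have hs := Real.hasDerivAt_sin q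
  have hc := Real.hasDerivAt_cos q
  refine (((((hc.const_mul (2 * u y)).mul_const (p ^ 2)).const_add (p ^ 4)).sub
    (((hs.const_mul (2 * v y)).mul_const p).mul_const r)).add
    ((hs.fun_pow 2).const_mul ((u y ^ 2 - v y ^ 2) / 2 + a / 4))).congr_deriv ?_
  simp only [Nat.reduceSub, Nat.cast_ofNat]
  ring

theorem hasDerivAt_quarticIntegral_height {y : ℝ} (hu : HasDerivAt u (v y) y)
    (hv : HasDerivAt v (w y) y) :
    HasDerivAt (fun t => quarticIntegral a u v (q, t, p, r))
      (2 * v y * Real.cos q * p ^ 2 - 2 * w y * Real.sin q * p * r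
        + (u y * v y - v y * w y) * Real.sin q ^ 2) y := by
  refine (((((hu.const_mul 2).mul_const (Real.cos q)).mul_const (p ^ 2)).const_add (p ^ 4)).sub
    ((((hv.const_mul 2).mul_const (Real.sin q)).mul_const p).mul_const r)).add
    (((((hu.fun_pow 2).sub (hv.fun_pow 2)).div_const 2).add_const (a / 4)).mul_const
      (Real.sin q ^ 2)) |>.congr_deriv ?_
  simp only [Nat.reduceSub, Nat.cast_ofNat]
  ring

theorem hasDerivAt_quarticIntegral_angleMomentum :
    HasDerivAt (fun t => quarticIntegral a u v (q, y, t, r))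
      (4 * p ^ 3 + 4 * u y * Real.cos q * p - 2 * v y * Real.sin q * r) p := by
  have hp := hasDerivAt_id' p
  refine ((((hp.fun_pow 4).add ((hp.fun_pow 2).const_mul (2 * u y * Real.cos q))).sub
    ((hp.const_mul (2 * v y * Real.sin q)).mul_const r)).add_const
    (((u y ^ 2 - v y ^ 2) / 2 + a / 4) * Real.sin q ^ 2)).congr_deriv ?_
  simp only [Nat.reduceSub, Nat.cast_ofNat]
  ring

theorem hasDerivAt_quarticIntegral_heightMomentum :
    HasDerivAt (fun t => quarticIntegral a u v (q, y, p, t)) (-2 * v y * Real.sin q * p) r := by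
  refine ((((hasDerivAt_id' r).const_mul (2 * v y * Real.sin q * p)).const_sub
    (p ^ 4 + 2 * u y * Real.cos q * p ^ 2)).add_const
    (((u y ^ 2 - v y ^ 2) / 2 + a / 4) * Real.sin q ^ 2)).congr_deriv ?_
  ring

theorem hasDerivAt_sphereHamiltonian_angle :
    HasDerivAt (fun t => sphereHamiltonian u v w (t, y, p, r))
      ((w y - u y) * v y ^ 2 * Real.sin q) q := by
  refine (((Real.hasDerivAt_cos q).const_mul ((w y - u y) * v y ^ 2)).const_sub
    (v y ^ 2 * (p ^ 2 + r ^ 2))).congr_deriv ?_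
  ring

theorem hasDerivAt_sphereHamiltonian_height {y z : ℝ} (hu : HasDerivAt u (v y) y)
    (hv : HasDerivAt v (w y) y) (hw : HasDerivAt w z y) :
    HasDerivAt (fun t => sphereHamiltonian u v w (q, t, p, r))
      (2 * v y * w y * (p ^ 2 + r ^ 2)
        - ((z - v y) * v y ^ 2 + (w y - u y) * (2 * v y * w y)) * Real.cos q) y := by
  refine (((hv.fun_pow 2).mul_const (p ^ 2 + r ^ 2)).sub
    (((hw.sub hu).mul (hv.fun_pow 2)).mul_const (Real.cos q))).congr_deriv ?_
  simp only [Pi.sub_apply, Nat.reduceSub, Nat.cast_ofNat]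
  ring

theorem hasDerivAt_sphereHamiltonian_angleMomentum :
    HasDerivAt (fun t => sphereHamiltonian u v w (q, y, t, r)) (2 * v y ^ 2 * p) p := by
  refine (((((hasDerivAt_id' p).fun_pow 2).add_const (r ^ 2)).const_mul (v y ^ 2)).sub_const
    ((w y - u y) * v y ^ 2 * Real.cos q)).congr_deriv ?_
  simp only [Nat.reduceSub, Nat.cast_ofNat]
  ring

theorem hasDerivAt_sphereHamiltonian_heightMomentum :
    HasDerivAt (fun t => sphereHamiltonian u v w (q, y, p, t)) (2 * v y ^ 2 * r) r := by
  refine (((((hasDerivAt_id' r).fun_pow 2).const_add (p ^ 2)).const_mul (v y ^ 2)).sub_const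
    ((w y - u y) * v y ^ 2 * Real.cos q)).congr_deriv ?_
  simp only [Nat.reduceSub, Nat.cast_ofNat]
  ring

end Derivatives

/-- The quartic integral Poisson commutes with the Hamiltonian as soon as
`2u''² - 3u² + u'u''' = a/2`. -/
theorem pbracket_quarticIntegral_eq_zero {a : ℝ} {u v w z : ℝ → ℝ}
    (hu : ∀ y, HasDerivAt u (v y) y) (hv : ∀ y, HasDerivAt v (w y) y)
    (hw : ∀ y, HasDerivAt w (z y) y)
    (hode : ∀ y, 2 * w y ^ 2 - 3 * u y ^ 2 + v y * z y = a / 2) (x : ℝ × ℝ × ℝ × ℝ) :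
    pbracket (quarticIntegral a u v) (sphereHamiltonian u v w) x = 0 := by
  obtain ⟨q, y, p, r⟩ := x
  simp only [pbracket]
  rw [(hasDerivAt_quarticIntegral_angle q y p r).deriv,
    (hasDerivAt_quarticIntegral_height q p r (hu y) (hv y)).deriv,
    (hasDerivAt_quarticIntegral_angleMomentum q y p r).deriv,
    (hasDerivAt_quarticIntegral_heightMomentum q y p r).deriv,
    (hasDerivAt_sphereHamiltonian_angle q y p r).deriv,
    (hasDerivAt_sphereHamiltonian_height q p r (hu y) (hv y) (hw y)).deriv,
    (hasDerivAt_sphereHamiltonian_angleMomentum q y p r).deriv,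
    (hasDerivAt_sphereHamiltonian_heightMomentum q y p r).deriv]
  linear_combination (-2 * v y ^ 2 * Real.sin q * Real.cos q * p) * hode y

theorem linearIndependent_fderiv_quarticIntegral (a : ℝ) {u v w : ℝ → ℝ}
    (hu : ContDiff ℝ (⊤ : ℕ∞) u) (hv : ContDiff ℝ (⊤ : ℕ∞) v) (hw : ContDiff ℝ (⊤ : ℕ∞) w)
    (y : ℝ) (hy : v y ≠ 0) :
    LinearIndependent ℝ ![fderiv ℝ (quarticIntegral a u v) (0, y, 1, 1),
      fderiv ℝ (sphereHamiltonian u v w) (0, y, 1, 1)] := by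
  have hF : ContDiff ℝ (⊤ : ℕ∞) (quarticIntegral a u v) := by
    unfold quarticIntegral
    fun_prop
  have hH : ContDiff ℝ (⊤ : ℕ∞) (sphereHamiltonian u v w) := by
    unfold sphereHamiltonian
    fun_prop
  have dF := (hF.differentiable (by simp) (0, y, 1, 1)).hasFDerivAt
  have dH := (hH.differentiable (by simp) (0, y, 1, 1)).hasFDerivAt
  have hangle : HasDerivAt (fun t : ℝ => (t, y, (1 : ℝ), (1 : ℝ))) (1, 0, 0, 0) 0 :=
    (hasDerivAt_id' 0).prodMk (hasDerivAt_const 0 (y, (1 : ℝ), (1 : ℝ)))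
  have hmom : HasDerivAt (fun t : ℝ => ((0 : ℝ), y, (1 : ℝ), t)) (0, 0, 0, 1) 1 :=
    (hasDerivAt_const 1 0).prodMk ((hasDerivAt_const 1 y).prodMk
      ((hasDerivAt_const 1 1).prodMk (hasDerivAt_id' 1)))
  have eF₁ := HasDerivAt.unique (f := fun t => quarticIntegral a u v (t, y, 1, 1))
    (dF.comp_hasDerivAt_of_eq 0 hangle rfl) (hasDerivAt_quarticIntegral_angle 0 y 1 1)
  have eH₁ := HasDerivAt.unique (f := fun t => sphereHamiltonian u v w (t, y, 1, 1))
    (dH.comp_hasDerivAt_of_eq 0 hangle rfl) (hasDerivAt_sphereHamiltonian_angle 0 y 1 1)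
  have eH₂ := HasDerivAt.unique (f := fun t => sphereHamiltonian u v w (0, y, 1, t))
    (dH.comp_hasDerivAt_of_eq 1 hmom rfl) (hasDerivAt_sphereHamiltonian_heightMomentum 0 y 1 1)
  rw [LinearIndependent.pair_iff]
  intro s t hst
  have h₁ := congrArg (fun L => L ((1, 0, 0, 0) : ℝ × ℝ × ℝ × ℝ)) hst
  have h₂ := congrArg (fun L => L ((0, 0, 0, 1) : ℝ × ℝ × ℝ × ℝ)) hst
  simp only [add_apply, smul_apply, zero_apply, smul_eq_mul, eF₁, eH₁] at h₁
  have hs : s = 0 := by simpa [hy] using h₁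
  subst hs
  simp only [add_apply, smul_apply, zero_apply, smul_eq_mul, eH₂] at h₂
  exact ⟨rfl, by simpa [hy] using h₂⟩

/-- For `a > −2` and `u` the global solution of
`u' = (1 + a u² + u⁴)^{1/4}` with `u 0 = 0`, the Hamiltonian
`H(φ, y, p_φ, p_y) = u'(y)² (p_φ² + p_y²) − (u''(y) − u(y)) u'(y)² cos φ`
possesses an integral of fourth degree in momenta. -/
theorem hamiltonian_H_quartic_integral (a : ℝ) (ha : -2 < a) (u : ℝ → ℝ)
    (hu : ∀ y : ℝ, HasDerivAt u ((1 + a * (u y) ^ 2 + (u y) ^ 4) ^ ((1 : ℝ) / 4)) y)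
    (h0 : u 0 = 0)
    (H : ℝ × ℝ × ℝ × ℝ → ℝ)
    (hH : ∀ v : ℝ × ℝ × ℝ × ℝ,
      H v = (deriv u v.2.1) ^ 2 * (v.2.2.1 ^ 2 + v.2.2.2 ^ 2)
        - (iteratedDeriv 2 u v.2.1 - u v.2.1) * (deriv u v.2.1) ^ 2
            * Real.cos v.1) :
    HasQuarticIntegral H := by
  set v : ℝ → ℝ := fun y => (1 + a * u y ^ 2 + u y ^ 4) ^ ((1 : ℝ) / 4)
  have hpos := one_add_mul_sq_add_pow_four_pos ha
  have hg : ContDiff ℝ (⊤ : ℕ∞) fun x : ℝ => (1 + a * x ^ 2 + x ^ 4) ^ ((1 : ℝ) / 4) :=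
    ContDiff.rpow_const_of_ne (by fun_prop) fun x => (hpos x).ne'
  have hus : ContDiff ℝ (⊤ : ℕ∞) u := contDiff_of_hasDerivAt_comp hg hu
  have hvs : ContDiff ℝ (⊤ : ℕ∞) v := hg.comp hus
  have hws : ContDiff ℝ (⊤ : ℕ∞) (deriv v) := (contDiff_infty_iff_deriv.1 hvs).2
  have hv (y : ℝ) : HasDerivAt v (deriv v y) y :=
    (hvs.differentiable (by simp) y).hasDerivAt
  have hw (y : ℝ) : HasDerivAt (deriv v) (deriv (deriv v) y) y :=
    (hws.differentiable (by simp) y).hasDerivAt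
  have hvpos (y : ℝ) : 0 < v y := Real.rpow_pos_of_pos (hpos _) _
  have hv4 (y : ℝ) : v y ^ 4 = 1 + a * u y ^ 2 + u y ^ 4 := by
    rw [← Real.rpow_natCast, ← Real.rpow_mul (hpos _).le]
    norm_num
  have hfirst (y : ℝ) : v y ^ 2 * deriv v y = a / 2 * u y + u y ^ 3 := by
    have h := ((hv y).fun_pow 4).unique ((((((hu y).fun_pow 2).const_mul a).const_add 1).add
      ((hu y).fun_pow 4)).congr_of_eventuallyEq (.of_forall hv4))
    apply mul_left_cancel₀ (hvpos y).ne'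
    push_cast at h
    linear_combination h / 4
  have hode (y : ℝ) : 2 * deriv v y ^ 2 - 3 * u y ^ 2 + v y * deriv (deriv v) y = a / 2 := by
    have h := (((hv y).fun_pow 2).mul (hw y)).unique ((((hu y).const_mul (a / 2)).add
      ((hu y).fun_pow 3)).congr_of_eventuallyEq (.of_forall hfirst))
    apply mul_left_cancel₀ (hvpos y).ne'
    push_cast at h
    linear_combination h
  have hdu : deriv u = v := funext fun y => (hu y).deriv
  have hHeq : H = sphereHamiltonian u v (deriv v) := by
    funext x
    rw [hH, iteratedDeriv_succ, iteratedDeriv_one, hdu, sphereHamiltonian]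
  subst hHeq
  exact ⟨quarticCoeff a u v, fun j k _ => contDiff_quarticCoeff a hus hvs j k,
    quarticIntegral a u v, quarticIntegral_eq_sum a u v,
    pbracket_quarticIntegral_eq_zero hu hv hw hode, _,
    linearIndependent_fderiv_quarticIntegral a hus hvs hws 0 (hvpos 0).ne'⟩
end
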